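/- arXiv:1809.09811 — 2 statements merged into one kernel-verified Lean document; each statement's English description precedes it below -/
import Mathlib

section
/- Let L = PSL_n(q) where q = p^a for a prime p with a ≥ 2 (i.e., q > p), and let n > 11. Then the prime graph GK(L) is not a split graph. -/
/-- The prime (Gruenberg–Kegel) graph of a finite group `G`, as a graph on `ℕ`:
distinct primes `r`, `s` are adjacent iff `G` has an element of order `r * s`. -/
def primeGraph (G : Type*) [Group G] : SimpleGraph ℕ where
  Adj r s := r ≠ s ∧ r.Prime ∧ s.Prime ∧ ∃ g : G, orderOf g = r * s
  symm := by
    refine ⟨?_⟩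
    rintro r s ⟨hne, hr, hs, g, hg⟩
    exact ⟨hne.symm, hs, hr, g, by rwa [Nat.mul_comm] at hg⟩
  loopless := by refine ⟨?_⟩; rintro r ⟨hne, _⟩; exact hne rfl

/-- A split partition of the graph `Γ` with vertex set `S`: a partition of `S`
into a clique `C` and an independent set `I`. -/
def SimpleGraph.IsSplitPartition {V : Type*} (Γ : SimpleGraph V) (S C I : Set V) : Prop :=
  C ∪ I = S ∧ Disjoint C I ∧ Γ.IsClique C ∧ I.Pairwise fun u v => ¬ Γ.Adj u v

/-- `Γ` (with vertex set `S`) is a split graph: `S` can be partitioned into a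
clique and an independent set. -/
def SimpleGraph.IsSplit {V : Type*} (Γ : SimpleGraph V) (S : Set V) : Prop :=
  ∃ C I : Set V, Γ.IsSplitPartition S C I

open Polynomial

theorem exists_eq_prime_pow_mul_of_dvd_cyclotomic_eval {x m r : ℕ} (hm : m ≠ 0) (hr : r.Prime)
    (h : (r : ℤ) ∣ (cyclotomic m ℤ).eval (x : ℤ)) :
    ∃ j d, m = r ^ j * d ∧ ¬ r ∣ d ∧ orderOf (x : ZMod r) = d := by
  have : Fact r.Prime := ⟨hr⟩
  obtain ⟨j, d, hd, rfl⟩ := Nat.exists_eq_pow_mul_and_not_dvd hm r hr.ne_one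
  refine ⟨j, d, rfl, hd, ?_⟩
  have : NeZero (d : ZMod r) := ⟨fun h0 ↦ hd ((ZMod.natCast_eq_zero_iff d r).1 h0)⟩
  have hroot : (cyclotomic (r ^ j * d) (ZMod r)).IsRoot (x : ZMod r) := by
    rw [IsRoot.def, ← map_cyclotomic_int, ← Int.cast_natCast (R := ZMod r) x,
      eval_intCast_map, eq_intCast]
    exact (ZMod.intCast_zmod_eq_zero_iff_dvd _ r).2 h
  exact (isRoot_cyclotomic_prime_pow_mul_iff_of_charP.1 hroot).eq_orderOf.symm

theorem orderOf_natCast_zmod_dvd_sub_one {x r : ℕ} (hr : r.Prime)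
    (h : orderOf (x : ZMod r) ≠ 0) : orderOf (x : ZMod r) ∣ r - 1 := by
  have : Fact r.Prime := ⟨hr⟩
  refine orderOf_dvd_of_pow_eq_one (ZMod.pow_card_sub_one_eq_one fun h0 ↦ h ?_)
  rw [h0]; simp

theorem cyclotomic_eval_dvd_geom_sum {x m r : ℕ} (hx : 2 ≤ x) (hr : r.Prime) (hm : m ≠ 0)
    (hrm : r ∣ m) :
    (cyclotomic m ℤ).eval (x : ℤ) ∣ ∑ i ∈ Finset.range r, ((x : ℤ) ^ (m / r)) ^ i := by
  have hlt : m / r < m := Nat.div_lt_self (Nat.pos_of_ne_zero hm) hr.one_lt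
  have hpos : m / r ≠ 0 := (Nat.div_pos (Nat.le_of_dvd (Nat.pos_of_ne_zero hm) hrm) hr.pos).ne'
  have h := X_pow_sub_one_mul_cyclotomic_dvd_X_pow_sub_one_of_dvd ℤ
    (Nat.mem_properDivisors.2 ⟨Nat.div_dvd_of_dvd hrm, hlt⟩)
  have h := eval_dvd (x := (x : ℤ)) h
  simp only [eval_mul, eval_sub, eval_pow, eval_X, eval_one] at h
  have hne : (x : ℤ) ^ (m / r) - 1 ≠ 0 := by
    have : (1 : ℤ) < (x : ℤ) ^ (m / r) := one_lt_pow₀ (by exact_mod_cast hx) hpos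
    omega
  refine (mul_dvd_mul_iff_left hne).1 (h.trans (dvd_of_eq ?_))
  rw [mul_geom_sum, ← pow_mul, Nat.div_mul_cancel hrm]

theorem not_sq_dvd_cyclotomic_eval {x m r : ℕ} (hx : 2 ≤ x) (hm : 2 < m) (hr : r.Prime)
    (hrm : r ∣ m) (h : (r : ℤ) ∣ (cyclotomic m ℤ).eval (x : ℤ)) :
    ¬ (r : ℤ) ^ 2 ∣ (cyclotomic m ℤ).eval (x : ℤ) := by
  intro hsq
  have hm0 : m ≠ 0 := by omega
  have hsum := hsq.trans (cyclotomic_eval_dvd_geom_sum hx hr hm0 hrm)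
  obtain ⟨j, d, hmd, hd, hord⟩ := exists_eq_prime_pow_mul_of_dvd_cyclotomic_eval hm0 hr h
  have hj : j ≠ 0 := by
    rintro rfl
    exact hd (by simpa [hmd] using hrm)
  obtain ⟨i, rfl⟩ := Nat.exists_eq_succ_of_ne_zero hj
  have hmr : m / r = r ^ i * d := by
    rw [hmd, Nat.succ_eq_add_one, pow_succ, mul_right_comm, Nat.mul_div_cancel _ hr.pos]
  have hdvd : (r : ℤ) ∣ (x : ℤ) ^ (m / r) - 1 := by
    rw [← ZMod.intCast_zmod_eq_zero_iff_dvd]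
    push_cast
    rw [sub_eq_zero, ← orderOf_dvd_iff_pow_eq_one, hord, hmr]
    exact dvd_mul_left _ _
  have hd0 : d ≠ 0 := by rintro rfl; simp at hd
  rcases hr.eq_two_or_odd' with rfl | hodd
  · have hd1 : d = 1 := by
      have := orderOf_natCast_zmod_dvd_sub_one hr (hord ▸ hd0)
      rw [hord] at this
      simpa using this
    subst hd1
    have hi : i ≠ 0 := by
      rintro rfl
      simp at hmd
      omega
    obtain ⟨l, rfl⟩ := Nat.exists_eq_succ_of_ne_zero hi
    have hy : (x : ℤ) ^ (m / 2) = ((x : ℤ) ^ (2 ^ l)) ^ 2 := by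
      rw [hmr, ← pow_mul, Nat.succ_eq_add_one, pow_succ, mul_one]
    rw [hy] at hdvd hsum
    generalize (x : ℤ) ^ (2 ^ l) = z at hdvd hsum
    simp only [Finset.sum_range_succ, Finset.sum_range_zero] at hsum
    rcases Int.even_or_odd' z with ⟨w, rfl | rfl⟩
    · ring_nf at hdvd; omega
    · ring_nf at hsum; omega
  · obtain ⟨b, hb⟩ := hdvd
    have h1 := odd_sq_dvd_geom_sum₂_sub (R := ℤ) (a := 1) (b := b) hodd
    have hy : (x : ℤ) ^ (m / r) = 1 + r * b := by linarith
    rw [hy] at hsum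
    simp only [one_pow, mul_one] at h1
    have h2 : (r : ℤ) ^ 2 ∣ r := by simpa using dvd_sub hsum h1
    have h3 : r ^ 2 ∣ r := by exact_mod_cast h2
    have := Nat.le_of_dvd hr.pos h3
    nlinarith [hr.two_le]

theorem cyclotomic_prime_pow_mul_eval {R : Type*} [CommRing R] {r : ℕ} (hr : r.Prime) (i d : ℕ)
    (x : R) :
    (cyclotomic (r ^ (i + 1) * d) R).eval x = (cyclotomic (d * r) R).eval (x ^ r ^ i) := by
  induction i generalizing x with
  | zero => simp [mul_comm]
  | succ i ih =>
    have : r ^ (i + 1 + 1) * d = r ^ (i + 1) * d * r := by ring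
    have hdvd : r ∣ r ^ (i + 1) * d := dvd_mul_of_dvd_left (dvd_pow_self r (by omega)) d
    rw [this, ← cyclotomic_expand_eq_cyclotomic hr hdvd R, expand_eval, ih, ← pow_mul, pow_succ' r i]

theorem lt_cyclotomic_mul_prime_eval {r d : ℕ} (hr : r.Prime) (hrd : ¬ r ∣ d) {y : ℝ} (hy : 1 < y)
    (h : r * (y + 1) < y ^ r - 1) : (r : ℝ) < (cyclotomic (d * r) ℝ).eval y := by
  have hd0 : 0 < d := Nat.pos_of_ne_zero (by rintro rfl; simp at hrd)
  have hφ : d.totient ≠ 0 := (Nat.totient_pos.2 hd0).ne'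
  have hyr : 1 < y ^ r := one_lt_pow₀ hy hr.ne_zero
  have h1 := sub_one_pow_totient_le_cyclotomic_eval (n := d) hyr
  have h2 := cyclotomic_eval_le_add_one_pow_totient (n := d) hy
  have h3 : (cyclotomic d ℝ).eval (y ^ r) =
      (cyclotomic (d * r) ℝ).eval y * (cyclotomic d ℝ).eval y := by
    rw [← expand_eval, cyclotomic_expand_eq_cyclotomic_mul hr hrd, eval_mul]
  have hpos : 0 < (cyclotomic (d * r) ℝ).eval y := cyclotomic_pos' _ hy
  have h4 : ((r : ℝ) * (y + 1)) ^ d.totient < (y ^ r - 1) ^ d.totient :=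
    pow_lt_pow_left₀ h (by positivity) hφ
  have h5 : (r : ℝ) ^ d.totient * (y + 1) ^ d.totient <
      (cyclotomic (d * r) ℝ).eval y * (y + 1) ^ d.totient := by
    rw [← mul_pow]
    calc _ < _ := h4
      _ ≤ _ := h1
      _ = _ := h3
      _ ≤ _ := by gcongr
  refine lt_of_le_of_lt ?_ (lt_of_mul_lt_mul_right h5 (by positivity))
  exact le_self_pow₀ (by exact_mod_cast hr.one_lt.le) hφ

theorem prime_mul_add_one_lt {r y : ℕ} (hr : r.Prime)
    (h : 5 ≤ r ∧ 2 ≤ y ∨ 4 ≤ y) : r * (y + 1) + 1 < y ^ r := by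
  obtain ⟨s, rfl⟩ : ∃ s, r = s + 2 := ⟨r - 2, by have := hr.two_le; omega⟩
  rcases h with ⟨h5, hy⟩ | hy
  · obtain ⟨t, rfl⟩ : ∃ t, s = t + 3 := ⟨s - 3, by omega⟩
    have h2 : 2 * (t + 5) + 1 ≤ 2 ^ (t + 4) := by
      clear h5 hr
      induction t with
      | zero => norm_num
      | succ t ih => rw [pow_succ 2 (t + 4)]; omega
    have h3 : 2 ^ (t + 4) ≤ y ^ (t + 4) := Nat.pow_le_pow_left hy _
    rw [show t + 3 + 2 = t + 4 + 1 from rfl, pow_succ y (t + 4)]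
    nlinarith
  · have h2 : 2 * s + 4 ≤ 4 ^ (s + 1) := by
      clear hr
      induction s with
      | zero => norm_num
      | succ t ih => rw [pow_succ 4 (t + 1)]; omega
    have h3 : 4 ^ (s + 1) ≤ y ^ (s + 1) := Nat.pow_le_pow_left hy _
    rw [pow_succ y (s + 1)]
    nlinarith

theorem lt_cyclotomic_eval_of_dvd {x m r : ℕ} (hx : 2 ≤ x) (hm : 7 ≤ m) (hr : r.Prime)
    (hrm : r ∣ m) (h : (r : ℤ) ∣ (cyclotomic m ℤ).eval (x : ℤ)) :
    (r : ℤ) < (cyclotomic m ℤ).eval (x : ℤ) := by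
  obtain ⟨j, d, hmd, hd, hord⟩ :=
    exists_eq_prime_pow_mul_of_dvd_cyclotomic_eval (by omega : m ≠ 0) hr h
  have hd0 : d ≠ 0 := by rintro rfl; simp at hd
  have hdr := orderOf_natCast_zmod_dvd_sub_one hr (hord ▸ hd0)
  rw [hord] at hdr
  have hj : j ≠ 0 := by
    rintro rfl
    exact hd (by simpa [hmd] using hrm)
  obtain ⟨i, rfl⟩ := Nat.exists_eq_succ_of_ne_zero hj
  have hdle : d ≤ r - 1 := Nat.le_of_dvd (by have := hr.two_le; omega) hdr
  have hy2 : 2 ≤ x ^ r ^ i := hx.trans (Nat.le_self_pow (pow_pos hr.pos i).ne' x)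
  have hy : 5 ≤ r ∧ 2 ≤ x ^ r ^ i ∨ 4 ≤ x ^ r ^ i := by
    by_cases h5 : 5 ≤ r
    · exact Or.inl ⟨h5, hy2⟩
    · right
      have hi : i ≠ 0 := by
        rintro rfl
        have : r ≤ 3 := by
          by_contra h4
          exact absurd hr (by rw [show r = 4 by omega]; decide)
        simp only [Nat.succ_eq_add_one, zero_add, pow_one] at hmd
        have := Nat.mul_le_mul this hdle
        omega
      have h2 : 2 ≤ r ^ i := hr.two_le.trans (Nat.le_self_pow hi r)
      calc 4 = 2 ^ 2 := rfl
        _ ≤ 2 ^ r ^ i := Nat.pow_le_pow_right (by norm_num) h2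
        _ ≤ _ := Nat.pow_le_pow_left hx _
  have key := lt_cyclotomic_mul_prime_eval (d := d) hr hd (y := ((x ^ r ^ i : ℕ) : ℝ))
    (by exact_mod_cast hy2) (by
      have := prime_mul_add_one_lt hr hy
      rw [lt_sub_iff_add_lt]
      exact_mod_cast this)
  rw [Nat.cast_pow, ← cyclotomic_prime_pow_mul_eval hr, ← Nat.succ_eq_add_one, ← hmd,
    ← map_cyclotomic_int, ← Int.cast_natCast x, eval_intCast_map, eq_intCast] at key
  exact_mod_cast key

/-- Zsigmondy's theorem for `x ^ m - 1` with `7 ≤ m`: there is a prime modulo which `x` has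
order exactly `m`. -/
theorem exists_prime_orderOf_natCast_zmod_eq {x m : ℕ} (hx : 2 ≤ x) (hm : 7 ≤ m) :
    ∃ r : ℕ, r.Prime ∧ orderOf (x : ZMod r) = m := by
  by_contra! hcon
  set N := ((cyclotomic m ℤ).eval (x : ℤ)) with hN
  have hm0 : m ≠ 0 := by omega
  have hNpos : 0 < N := cyclotomic_pos' m (by exact_mod_cast hx)
  have hdvd : ∀ r : ℕ, r.Prime → (r : ℤ) ∣ N → r ∣ m ∧ ∀ s : ℕ, s.Prime → s ∣ m → s ≤ r := by
    intro r hr hrN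
    obtain ⟨j, d, hmd, hd, hord⟩ := exists_eq_prime_pow_mul_of_dvd_cyclotomic_eval hm0 hr hrN
    have hd0 : d ≠ 0 := by rintro rfl; simp at hd
    have hdr := orderOf_natCast_zmod_dvd_sub_one hr (hord ▸ hd0)
    rw [hord] at hdr
    have hj : j ≠ 0 := by
      rintro rfl
      exact hcon r hr (by simpa [hmd] using hord)
    refine ⟨hmd ▸ dvd_mul_of_dvd_left (dvd_pow_self r hj) d, fun s hs hsm ↦ ?_⟩
    rw [hmd] at hsm
    rcases (hs.dvd_mul).1 hsm with h | h
    · exact Nat.le_of_dvd hr.pos (hs.dvd_of_dvd_pow h)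
    · have := Nat.le_of_dvd (by have := hr.two_le; omega) (h.trans hdr)
      omega
  have hN1 : N.natAbs ≠ 1 := by
    have := sub_one_lt_natAbs_cyclotomic_eval (n := m) (q := x) (by omega) (by omega)
    omega
  obtain ⟨r, hr, hrN⟩ := Nat.exists_prime_and_dvd hN1
  have hrN := Int.natCast_dvd.2 hrN
  obtain ⟨hrm, hrmax⟩ := hdvd r hr hrN
  obtain ⟨c, hc⟩ := hrN
  have hlt : (r : ℤ) < N := lt_cyclotomic_eval_of_dvd hx hm hr hrm ⟨c, hc⟩
  have hr0 : (0 : ℤ) < r := by exact_mod_cast hr.pos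
  have hc1 : c.natAbs ≠ 1 := by
    intro h1
    rcases Int.natAbs_eq c with h | h <;> rw [h1] at h <;> subst h <;> push_cast at hc <;> linarith
  obtain ⟨s, hs, hsc⟩ := Nat.exists_prime_and_dvd hc1
  have hsc := Int.natCast_dvd.2 hsc
  have hsN : (s : ℤ) ∣ N := hc ▸ dvd_mul_of_dvd_right hsc _
  obtain ⟨hsm, hsmax⟩ := hdvd s hs hsN
  obtain rfl : s = r := le_antisymm (hrmax s hs hsm) (hsmax r hr hrm)
  refine not_sq_dvd_cyclotomic_eval hx (by omega) hr hrm ⟨c, hc⟩ ?_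
  rw [← hN, hc, sq]
  exact mul_dvd_mul_left _ hsc

theorem coprime_sub_one_of_orderOf_natCast_ne_one {q r : ℕ} (hq : 0 < q) (hr : r.Prime)
    (h : orderOf (q : ZMod r) ≠ 1) : r.Coprime (q - 1) := by
  rw [hr.coprime_iff_not_dvd]
  intro hdvd
  apply h
  rw [orderOf_eq_one_iff]
  have := (ZMod.natCast_eq_zero_iff (q - 1) r).2 hdvd
  rw [Nat.cast_sub hq, Nat.cast_one, sub_eq_zero] at this
  exact this

theorem coprime_of_orderOf_natCast_ne_zero {q r : ℕ} (h : orderOf (q : ZMod r) ≠ 0) :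
    q.Coprime r := by
  rw [← ZMod.isUnit_iff_coprime]
  exact (orderOf_ne_zero_iff.1 h).isUnit

theorem X_pow_mul_sub_one_eq (K : Type*) [CommRing K] {r s : ℕ} (hr : r.Prime) (hs : s.Prime)
    (hrs : r ≠ s) :
    (X ^ (r * s) - 1 : K[X]) = (X ^ s - 1) * (cyclotomic r K * cyclotomic (r * s) K) := by
  have h1 : (X ^ (r * s) - 1 : K[X]) = expand K r (X ^ s - 1) := by
    simp [← pow_mul]
  have hns : ¬ r ∣ s := fun h ↦ hrs ((Nat.prime_dvd_prime_iff_eq hr hs).1 h)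
  have : Fact s.Prime := ⟨hs⟩
  have : Fact r.Prime := ⟨hr⟩
  have h3 : (X ^ s - 1 : K[X]) = cyclotomic s K * (X - 1) := by
    rw [cyclotomic_prime_mul_X_sub_one]
  rw [h1, h3, map_mul, cyclotomic_expand_eq_cyclotomic_mul hr hns, mul_comm s r, map_sub, expand_X,
    map_one, ← cyclotomic_prime_mul_X_sub_one K r]
  ring

/-- If `M` has order `r * s` for distinct primes `r` and `s`, then its minimal polynomial has an
irreducible factor whose roots have order `r` or `r * s`. -/
theorem exists_irreducible_dvd_minpoly {F : Type*} [Field F] {n r s : ℕ} (hr : r.Prime)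
    (hs : s.Prime) (hrs : r ≠ s) {M : Matrix (Fin n) (Fin n) F} (hM : orderOf M = r * s) :
    ∃ P : F[X], Irreducible P ∧ P ∣ minpoly F M ∧
      (P ∣ cyclotomic r F ∨ P ∣ cyclotomic (r * s) F) := by
  have hdvd : minpoly F M ∣ X ^ (r * s) - 1 := minpoly.dvd _ _ (by simp [← hM, pow_orderOf_eq_one])
  rw [X_pow_mul_sub_one_eq F hr hs hrs] at hdvd
  have hnot : ¬ IsCoprime (minpoly F M) (cyclotomic r F * cyclotomic (r * s) F) := by
    intro hc
    have h1 := aeval_eq_zero_of_dvd_aeval_eq_zero (hc.dvd_of_dvd_mul_right hdvd) (minpoly.aeval F M)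
    simp only [map_sub, map_pow, aeval_X, map_one, sub_eq_zero] at h1
    have := Nat.le_of_dvd hs.pos (hM ▸ orderOf_dvd_of_pow_eq_one h1)
    nlinarith [hr.two_le, hs.pos]
  obtain ⟨P, hP, hP1, hP2⟩ : ∃ P : F[X], Irreducible P ∧ P ∣ minpoly F M ∧
      P ∣ cyclotomic r F * cyclotomic (r * s) F := by
    by_contra! hcon
    refine hnot (isCoprime_of_irreducible_dvd ?_ hcon)
    exact fun h ↦ minpoly.ne_zero (Matrix.isIntegral M) h.1
  exact ⟨P, hP, hP1, hP.prime.dvd_or_dvd hP2⟩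

section FiniteField

variable {F : Type*} [Field F] [Fintype F]

theorem natDegree_of_irreducible_dvd_cyclotomic {d : ℕ} (hd : (Fintype.card F).Coprime d)
    {P : F[X]} (hP : Irreducible P) (hPd : P ∣ cyclotomic d F) :
    P.natDegree = orderOf (Fintype.card F : ZMod d) := by
  obtain ⟨p, _, n, hp, hcard⟩ := FiniteField.card' F
  have : Fact p.Prime := ⟨hp⟩
  have hpd : p.Coprime d := by
    rw [hcard] at hd
    exact Nat.Coprime.coprime_dvd_left (dvd_pow_self p n.ne_zero) hd
  rw [natDegree_of_dvd_cyclotomic_of_irreducible hcard hpd hPd hP, ← orderOf_units,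
    ZMod.coe_unitOfCoprime, hcard]

theorem orderOf_matrix_ne_mul {n k l r s : ℕ} (hr : r.Prime) (hs : s.Prime)
    (hk : orderOf (Fintype.card F : ZMod r) = k) (hl : orderOf (Fintype.card F : ZMod s) = l)
    (hkl : k ≠ l) (hkn : n < 2 * k) (hln : n < 2 * l) (M : Matrix (Fin n) (Fin n) F) :
    orderOf M ≠ r * s := by
  intro hM
  have hrs : r ≠ s := by rintro rfl; exact hkl (hk.symm.trans hl)
  have hqr := coprime_of_orderOf_natCast_ne_zero (q := Fintype.card F) (r := r) (by omega)
  have hqs := coprime_of_orderOf_natCast_ne_zero (q := Fintype.card F) (r := s) (by omega)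
  have hdeg : (minpoly F M).natDegree ≤ n := by
    have h := natDegree_le_of_dvd M.minpoly_dvd_charpoly M.charpoly_monic.ne_zero
    rwa [M.charpoly_natDegree_eq_dim, Fintype.card_fin] at h
  have hm0 : minpoly F M ≠ 0 := minpoly.ne_zero (Matrix.isIntegral M)
  have hbig : ∀ P : F[X], Irreducible P → P ∣ minpoly F M → ¬ P ∣ cyclotomic (r * s) F := by
    intro P hP hPm hPc
    have hd := natDegree_of_irreducible_dvd_cyclotomic (hqr.mul_right hqs) hP hPc
    have hle := (natDegree_le_of_dvd hPm hm0).trans hdeg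
    have h1 := orderOf_map_dvd (ZMod.castHom (dvd_mul_right r s) (ZMod r)).toMonoidHom
      (Fintype.card F : ZMod (r * s))
    have h2 := orderOf_map_dvd (ZMod.castHom (dvd_mul_left s r) (ZMod s)).toMonoidHom
      (Fintype.card F : ZMod (r * s))
    rw [RingHom.toMonoidHom_eq_coe, MonoidHom.coe_coe, map_natCast, hk, ← hd] at h1
    rw [RingHom.toMonoidHom_eq_coe, MonoidHom.coe_coe, map_natCast, hl, ← hd] at h2
    obtain ⟨u, hu⟩ := h1
    obtain ⟨v, hv⟩ := h2
    have hpos := hP.natDegree_pos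
    have hu1 : u = 1 := by
      have : u ≠ 0 := by rintro rfl; omega
      have : u < 2 := by by_contra! h; nlinarith
      omega
    have hv1 : v = 1 := by
      have : v ≠ 0 := by rintro rfl; omega
      have : v < 2 := by by_contra! h; nlinarith
      omega
    subst hu1 hv1
    omega
  obtain ⟨P, hP, hPm, hPr⟩ := exists_irreducible_dvd_minpoly hr hs hrs hM
  obtain ⟨Q, hQ, hQm, hQs⟩ := exists_irreducible_dvd_minpoly hs hr hrs.symm
    (hM.trans (mul_comm r s))
  rw [mul_comm s r] at hQs
  have hPd := natDegree_of_irreducible_dvd_cyclotomic hqr hP (hPr.resolve_right (hbig P hP hPm))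
  have hQd := natDegree_of_irreducible_dvd_cyclotomic hqs hQ (hQs.resolve_right (hbig Q hQ hQm))
  rw [hk] at hPd
  rw [hl] at hQd
  have hcop : IsCoprime P Q := by
    refine (hP.coprime_iff_not_dvd).2 fun h ↦ hkl ?_
    rw [← hPd, ← hQd]
    exact natDegree_eq_of_degree_eq (degree_eq_degree_of_associated (hP.associated_of_dvd hQ h))
  have h := (natDegree_le_of_dvd (hcop.mul_dvd hPm hQm) hm0).trans hdeg
  rw [natDegree_mul hP.ne_zero hQ.ne_zero] at h
  omega

theorem pow_card_sub_one_eq_one_of_mem_center {n : ℕ} {g : Matrix.SpecialLinearGroup (Fin n) F}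
    (hn : n ≠ 0) (hg : g ∈ Subgroup.center (Matrix.SpecialLinearGroup (Fin n) F)) :
    g ^ (Fintype.card F - 1) = 1 := by
  obtain ⟨c, hc, hcg⟩ := Matrix.SpecialLinearGroup.mem_center_iff.1 hg
  have hc0 : c ≠ 0 := by
    rintro rfl
    simp [hn] at hc
  apply Subtype.ext
  rw [Matrix.SpecialLinearGroup.coe_pow, ← hcg, ← map_pow, FiniteField.pow_card_sub_one_eq_one c hc0]
  simp

theorem exists_orderOf_psl_iff {n N : ℕ} (hn : n ≠ 0) (hN : N.Coprime (Fintype.card F - 1)) :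
    (∃ g : Matrix.ProjectiveSpecialLinearGroup (Fin n) F, orderOf g = N) ↔
      ∃ g : Matrix.SpecialLinearGroup (Fin n) F, orderOf g = N := by
  constructor
  · rintro ⟨h, rfl⟩
    obtain ⟨g, rfl⟩ := QuotientGroup.mk_surjective h
    refine ⟨g ^ (Fintype.card F - 1), Nat.dvd_antisymm ?_ ?_⟩
    · apply orderOf_dvd_of_pow_eq_one
      rw [← pow_mul, mul_comm, pow_mul]
      apply pow_card_sub_one_eq_one_of_mem_center hn
      rw [← QuotientGroup.eq_one_iff, QuotientGroup.mk_pow, pow_orderOf_eq_one]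
    · refine dvd_trans (dvd_of_eq ?_) (orderOf_map_dvd
        (QuotientGroup.mk' (Subgroup.center (Matrix.SpecialLinearGroup (Fin n) F))) _)
      rw [map_pow, QuotientGroup.mk'_apply, Nat.Coprime.orderOf_pow hN]
  · rintro ⟨g, rfl⟩
    refine ⟨QuotientGroup.mk' _ g, Nat.dvd_antisymm (orderOf_map_dvd _ _) ?_⟩
    refine hN.dvd_of_dvd_mul_right (orderOf_dvd_of_pow_eq_one ?_)
    rw [pow_mul]
    apply pow_card_sub_one_eq_one_of_mem_center hn
    rw [← QuotientGroup.eq_one_iff, QuotientGroup.mk_pow]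
    exact pow_orderOf_eq_one _

theorem exists_orderOf_specialLinearGroup {n k N : ℕ} (hk : k ≠ 0) (hkn : k ≤ n)
    (hN : N.Coprime (Fintype.card F - 1)) (hNk : N ∣ Fintype.card F ^ k - 1) :
    ∃ g : Matrix.SpecialLinearGroup (Fin n) F, orderOf g = N := by
  obtain ⟨p, _, _, hp, -⟩ := FiniteField.card' F
  have : Fact p.Prime := ⟨hp⟩
  have : NeZero k := ⟨hk⟩
  let K := FiniteField.Extension F p k
  let b : Module.Basis (Fin k) F K :=
    Module.finBasisOfFinrankEq F K (FiniteField.finrank_extension F p k)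
  obtain ⟨y, hy⟩ := IsCyclic.exists_ofOrder_eq_natCard (α := Kˣ)
  have hcard : Nat.card Kˣ = Fintype.card F ^ k - 1 := by
    rw [Nat.card_units, FiniteField.natCard_extension, Nat.card_eq_fintype_card]
  obtain ⟨x, hx⟩ : ∃ x : Kˣ, orderOf x = N :=
    ⟨_, orderOf_pow_orderOf_div (orderOf_pos y).ne' (by rwa [hy, hcard])⟩
  have hnorm : Algebra.norm F (x : K) = 1 := by
    have h1 : Algebra.norm F (x : K) ^ N = 1 := by
      rw [← map_pow, ← Units.val_pow_eq_pow_val, ← hx, pow_orderOf_eq_one, Units.val_one, map_one]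
    have h2 : Algebra.norm F (x : K) ^ (Fintype.card F - 1) = 1 :=
      FiniteField.pow_card_sub_one_eq_one _ (Algebra.norm_ne_zero_iff.2 x.ne_zero)
    have h3 := Nat.dvd_gcd (orderOf_dvd_of_pow_eq_one h1) (orderOf_dvd_of_pow_eq_one h2)
    rwa [hN.gcd_eq_one, Nat.dvd_one, orderOf_eq_one_iff] at h3
  let e : Fin k ⊕ Fin (n - k) ≃ Fin n := finSumFinEquiv.trans (finCongr (by omega))
  let A := Algebra.leftMulMatrix b (x : K)
  let g : Matrix.SpecialLinearGroup (Fin n) F :=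
    ⟨Matrix.reindexAlgEquiv F F e (Matrix.fromBlocks A 0 0 1), by
      rw [Matrix.coe_reindexAlgEquiv, Matrix.det_reindex_self, Matrix.det_fromBlocks_zero₂₁,
        Matrix.det_one, mul_one, ← Algebra.norm_eq_matrix_det b, hnorm]⟩
  refine ⟨g, hx ▸ orderOf_eq_orderOf_iff.2 fun j ↦ ?_⟩
  rw [← Matrix.SpecialLinearGroup.coeMonoidHom_injective.eq_iff, map_pow, map_one]
  change Matrix.reindexAlgEquiv F F e (Matrix.fromBlocks A 0 0 1) ^ j = 1 ↔ _
  rw [← map_pow, map_eq_one_iff _ (Matrix.reindexAlgEquiv F F e).injective,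
    Matrix.fromBlocks_diagonal_pow, one_pow, ← Matrix.fromBlocks_one, Matrix.fromBlocks_inj,
    ← map_pow, map_eq_one_iff _ (Algebra.leftMulMatrix_injective b)]
  simp [Units.ext_iff]

theorem primeGraph_psl_adj {n k r s : ℕ} (hr : r.Prime) (hs : s.Prime) (hrs : r ≠ s)
    (hk : 2 ≤ k) (hkn : k ≤ n) (hkr : orderOf (Fintype.card F : ZMod r) = k)
    (hks : orderOf (Fintype.card F : ZMod s) = k) :
    (primeGraph (Matrix.ProjectiveSpecialLinearGroup (Fin n) F)).Adj r s := by
  have hN : (r * s).Coprime (Fintype.card F - 1) :=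
    (coprime_sub_one_of_orderOf_natCast_ne_one Fintype.card_pos hr (by omega)).mul_left
      (coprime_sub_one_of_orderOf_natCast_ne_one Fintype.card_pos hs (by omega))
  have hdvd : ∀ t : ℕ, orderOf (Fintype.card F : ZMod t) = k → t ∣ Fintype.card F ^ k - 1 := by
    intro t ht
    rw [← ZMod.natCast_eq_zero_iff, Nat.cast_sub (Nat.one_le_pow _ _ Fintype.card_pos),
      Nat.cast_pow, ← ht, pow_orderOf_eq_one, Nat.cast_one, sub_self]
  exact ⟨hrs, hr, hs, (exists_orderOf_psl_iff (by omega) hN).2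
    (exists_orderOf_specialLinearGroup (by omega) hkn hN
      (((Nat.coprime_primes hr hs).2 hrs).mul_dvd_of_dvd_of_dvd (hdvd r hkr) (hdvd s hks)))⟩

theorem not_primeGraph_psl_adj {n k l r s : ℕ} (hk : orderOf (Fintype.card F : ZMod r) = k)
    (hl : orderOf (Fintype.card F : ZMod s) = l) (hkl : k ≠ l) (hn : 2 ≤ n) (hkn : n < 2 * k)
    (hln : n < 2 * l) :
    ¬ (primeGraph (Matrix.ProjectiveSpecialLinearGroup (Fin n) F)).Adj r s := by
  rintro ⟨-, hr, hs, hex⟩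
  have hN : (r * s).Coprime (Fintype.card F - 1) :=
    (coprime_sub_one_of_orderOf_natCast_ne_one Fintype.card_pos hr (by omega)).mul_left
      (coprime_sub_one_of_orderOf_natCast_ne_one Fintype.card_pos hs (by omega))
  obtain ⟨g, hg⟩ := (exists_orderOf_psl_iff (by omega) hN).1 hex
  refine orderOf_matrix_ne_mul hr hs hk hl hkl hkn hln (g : Matrix (Fin n) (Fin n) F) ?_
  rw [← hg]
  exact orderOf_injective Matrix.SpecialLinearGroup.coeMonoidHom
    Matrix.SpecialLinearGroup.coeMonoidHom_injective g

end FiniteField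

theorem prime_and_dvd_card_of_primeGraph_adj {G : Type*} [Group G] {r s : ℕ}
    (h : (primeGraph G).Adj r s) : r.Prime ∧ r ∣ Nat.card G := by
  obtain ⟨-, hr, -, g, hg⟩ := h
  exact ⟨hr, (hg ▸ dvd_mul_right r s).trans (orderOf_dvd_natCard g)⟩

/-- A graph containing two disjoint edges with no edge between them is not split. -/
theorem SimpleGraph.not_isSplit_of_disjoint_edges {V : Type*} {Γ : SimpleGraph V} {S : Set V}
    {r₁ r₂ s₁ s₂ : V} (hr₁ : r₁ ∈ S) (hr₂ : r₂ ∈ S) (hs₁ : s₁ ∈ S) (hs₂ : s₂ ∈ S)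
    (hr : Γ.Adj r₁ r₂) (hs : Γ.Adj s₁ s₂)
    (h : ∀ u ∈ ({r₁, r₂} : Set V), ∀ v ∈ ({s₁, s₂} : Set V), u ≠ v ∧ ¬ Γ.Adj u v) :
    ¬ Γ.IsSplit S := by
  rintro ⟨C, I, rfl, -, hC, hI⟩
  have key : ∀ u v, u ∈ C ∪ I → v ∈ C ∪ I → Γ.Adj u v → ∃ w ∈ ({u, v} : Set V), w ∈ C := by
    intro u v hu hv huv
    by_contra! hcon
    exact hI (hu.resolve_left (hcon u (by simp))) (hv.resolve_left (hcon v (by simp))) huv.ne huv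
  obtain ⟨u, hu, huC⟩ := key _ _ hr₁ hr₂ hr
  obtain ⟨v, hv, hvC⟩ := key _ _ hs₁ hs₂ hs
  exact (h u hu v hv).2 (hC huC hvC (h u hu v hv).1)

theorem exists_lt_not_dvd_of_two_le {l n : ℕ} (hl : 2 ≤ l) (hn : 3 ≤ n) :
    ∃ k m, n - 3 ≤ k ∧ k < m ∧ m ≤ n ∧ ¬ l ∣ k ∧ ¬ l ∣ m := by
  have hcons : ∀ t, l ∣ t → ¬ l ∣ t + 1 := by
    intro t h1 h2
    have := Nat.le_of_dvd one_pos ((Nat.dvd_add_right h1).1 h2)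
    omega
  obtain ⟨t, rfl⟩ := Nat.exists_eq_add_of_le' hn
  have h0 := hcons t
  have h1 := hcons (t + 1)
  have h2 := hcons (t + 2)
  by_cases h : l ∣ t + 3
  · by_cases h' : l ∣ t + 1
    · exact ⟨t, t + 2, by omega, by omega, by omega, by tauto, by tauto⟩
    · exact ⟨t + 1, t + 2, by omega, by omega, by omega, by tauto, by tauto⟩
  · by_cases h' : l ∣ t + 2
    · exact ⟨t + 1, t + 3, by omega, by omega, by omega, by tauto, by tauto⟩
    · exact ⟨t + 2, t + 3, by omega, by omega, by omega, by tauto, by tauto⟩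

/-- If some prime factor of `a` does not divide `k`, then `x ^ a` has order `k` modulo at least two
primes: one modulo which `x` has order `a * k`, and one modulo which its order is smaller. -/
theorem exists_two_primes_orderOf_natCast_pow_eq {x a k l : ℕ} (hx : 2 ≤ x) (ha : a ≠ 0)
    (hl : l.Prime) (hla : l ∣ a) (hlk : ¬ l ∣ k) (hk : 7 ≤ k) :
    ∃ r s : ℕ, r.Prime ∧ s.Prime ∧ r ≠ s ∧ orderOf ((x ^ a : ℕ) : ZMod r) = k ∧
      orderOf ((x ^ a : ℕ) : ZMod s) = k := by
  obtain ⟨v, c, hc, hac⟩ := Nat.exists_eq_pow_mul_and_not_dvd ha l hl.ne_one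
  have hc0 : 0 < c := Nat.pos_of_ne_zero (by rintro rfl; simp at hc)
  have hca : c ≠ a := by
    rintro rfl
    exact hc hla
  obtain ⟨r, hr, hro⟩ := exists_prime_orderOf_natCast_zmod_eq hx
    (hk.trans (Nat.le_mul_of_pos_left k (Nat.pos_of_ne_zero ha)))
  obtain ⟨s, hs, hso⟩ := exists_prime_orderOf_natCast_zmod_eq hx
    (hk.trans (Nat.le_mul_of_pos_left k hc0))
  refine ⟨r, s, hr, hs, ?_, ?_, ?_⟩
  · rintro rfl
    exact hca.symm (Nat.eq_of_mul_eq_mul_right (by omega) (hro.symm.trans hso))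
  · rw [Nat.cast_pow, orderOf_pow' _ ha, hro, Nat.gcd_eq_right (dvd_mul_right a k),
      Nat.mul_div_cancel_left k (Nat.pos_of_ne_zero ha)]
  · have hcop : k.Coprime (l ^ v) := ((hl.coprime_iff_not_dvd.2 hlk).symm).pow_right v
    rw [Nat.cast_pow, orderOf_pow' _ ha, hso, hac, mul_comm (l ^ v) c, Nat.gcd_mul_left,
      hcop.gcd_eq_one, mul_one, Nat.mul_div_cancel_left k hc0]

/-- for `L = PSL_n(q)` with `q = p ^ a` a proper prime power
(`a ≥ 2`) and `n > 11`, the prime graph of `L` is not split. -/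
theorem primeGraph_psl_not_split (p a n : ℕ) (hp : p.Prime) (ha : 2 ≤ a) (hn : 11 < n)
    (F : Type*) [Field F] [Fintype F] (hF : Fintype.card F = p ^ a) :
    ¬ (primeGraph (Matrix.ProjectiveSpecialLinearGroup (Fin n) F)).IsSplit
      {r : ℕ | r.Prime ∧ r ∣ Nat.card (Matrix.ProjectiveSpecialLinearGroup (Fin n) F)} := by
  have hl := Nat.minFac_prime (show a ≠ 1 by omega)
  obtain ⟨k, m, hkn, hkm, hmn, hlk, hlm⟩ :=
    exists_lt_not_dvd_of_two_le (n := n) hl.two_le (by omega)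
  obtain ⟨r₁, r₂, hr₁, hr₂, hr, hor₁, hor₂⟩ := exists_two_primes_orderOf_natCast_pow_eq hp.two_le
    (by omega) hl a.minFac_dvd hlk (by omega)
  obtain ⟨s₁, s₂, hs₁, hs₂, hs, hos₁, hos₂⟩ := exists_two_primes_orderOf_natCast_pow_eq hp.two_le
    (by omega) hl a.minFac_dvd hlm (by omega)
  rw [← hF] at hor₁ hor₂ hos₁ hos₂
  have hrr := primeGraph_psl_adj (n := n) hr₁ hr₂ hr (by omega) (by omega) hor₁ hor₂
  have hss := primeGraph_psl_adj (n := n) hs₁ hs₂ hs (by omega) (by omega) hos₁ hos₂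
  refine SimpleGraph.not_isSplit_of_disjoint_edges (prime_and_dvd_card_of_primeGraph_adj hrr)
    (prime_and_dvd_card_of_primeGraph_adj hrr.symm) (prime_and_dvd_card_of_primeGraph_adj hss)
    (prime_and_dvd_card_of_primeGraph_adj hss.symm) hrr hss fun u hu v hv ↦ ?_
  have hou : orderOf (Fintype.card F : ZMod u) = k := by
    rcases hu with rfl | rfl <;> assumption
  have hov : orderOf (Fintype.card F : ZMod v) = m := by
    rcases hv with rfl | rfl <;> assumption
  refine ⟨?_, not_primeGraph_psl_adj hou hov hkm.ne (by omega) (by omega) (by omega)⟩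
  rintro rfl
  omega
end

section
/- For every prime power q ≥ 4, the compact form GK_c(PSL_2(q)) of the prime graph of PSL_2(q) is a split graph. -/
/-- The closed neighborhood of a vertex. -/
def closedNbhd {V : Type*} (Γ : SimpleGraph V) (v : V) : Set V := insert v (Γ.neighborSet v)

/-- Vertices are equivalent iff they have the same closed neighborhood. -/
def nbhdSetoid {V : Type*} (Γ : SimpleGraph V) : Setoid V where
  r u v := closedNbhd Γ u = closedNbhd Γ v
  iseqv := ⟨fun _ => rfl, Eq.symm, Eq.trans⟩

/-- The compact form of `Γ`: the quotient of `Γ` by equality of closed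
neighborhoods; two distinct classes are adjacent iff some representatives are. -/
def compactForm {V : Type*} (Γ : SimpleGraph V) :
    SimpleGraph (Quotient (nbhdSetoid Γ)) where
  Adj a b := a ≠ b ∧ ∃ u v : V,
    Quotient.mk (nbhdSetoid Γ) u = a ∧ Quotient.mk (nbhdSetoid Γ) v = b ∧ Γ.Adj u v
  symm := by
    refine ⟨?_⟩
    rintro a b ⟨hne, u, v, hu, hv, huv⟩
    exact ⟨hne.symm, v, u, hv, hu, huv.symm⟩
  loopless := by refine ⟨?_⟩; rintro a ⟨hne, _⟩; exact hne rfl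

/-- The prime (Gruenberg–Kegel) graph of a finite group `G` on its genuine
vertex set: the primes dividing the order of `G`. -/
def primeGraphOn (G : Type*) [Group G] :
    SimpleGraph {p : ℕ // p.Prime ∧ p ∣ Nat.card G} where
  Adj r s := r ≠ s ∧ ∃ g : G, orderOf g = r.val * s.val
  symm := by
    refine ⟨?_⟩
    rintro r s ⟨hne, g, hg⟩
    exact ⟨hne.symm, g, by rwa [Nat.mul_comm] at hg⟩
  loopless := by refine ⟨?_⟩; rintro r ⟨hne, _⟩; exact hne rfl

open Polynomial in
/-- In an extension of a finite field with `q` elements, the solutions of `x ^ q = x` are the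
elements of the base field. -/
theorem exists_algebraMap_eq_of_pow_card_eq_self {F K : Type*} [Field F] [Fintype F] [Field K]
    [Algebra F K] {x : K} (hx : x ^ Fintype.card F = x) : ∃ a : F, algebraMap F K a = x := by
  have hroots := FiniteField.roots_X_pow_card_sub_X F
  have hmonic : (X ^ Fintype.card F - X : F[X]).Monic :=
    monic_X_pow_sub (by rw [degree_X]; exact_mod_cast Fintype.one_lt_card)
  have hprod := prod_multiset_X_sub_C_of_monic_of_roots_card_eq hmonic (by
    rw [hroots, FiniteField.X_pow_card_sub_X_natDegree_eq F Fintype.one_lt_card]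
    rfl)
  have heval := congrArg (aeval x) hprod
  rw [hroots] at heval
  change aeval x (∏ a : F, (X - C a)) = _ at heval
  rw [map_prod] at heval
  simp only [map_sub, aeval_X, aeval_C, map_pow, hx, sub_self] at heval
  obtain ⟨a, -, ha⟩ := Finset.prod_eq_zero_iff.1 heval
  exact ⟨a, (sub_eq_zero.1 ha).symm⟩

/-- The powers of an element annihilated by `(X - a) (X - b)`. -/
theorem sub_smul_pow_of_quadratic {K R : Type*} [CommRing K] [Ring R] [Algebra K R] {a b : K}
    {B : R} (hB : B * B = (a + b) • B - (a * b) • 1) (k : ℕ) :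
    (a - b) • B ^ k = a ^ k • (B - b • 1) - b ^ k • (B - a • 1) := by
  induction k with
  | zero => simp only [pow_zero, one_smul]; module
  | succ k ih =>
    rw [pow_succ, ← smul_mul_assoc, ih]
    simp only [sub_mul, smul_mul_assoc, one_mul, hB]
    module

open Matrix in
theorem Matrix.SpecialLinearGroup.mul_self_fin_two {R : Type*} [CommRing R]
    (A : SpecialLinearGroup (Fin 2) R) :
    A.val * A.val = A.val.trace • A.val - (1 : Matrix (Fin 2) (Fin 2) R) := by
  have hdet := A.det_coe
  rw [det_fin_two] at hdet
  ext i j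
  fin_cases i <;> fin_cases j <;>
    simp [mul_apply, Fin.sum_univ_two, trace_fin_two] <;>
    first | ring1 | linear_combination -hdet

open Matrix in
/-- An element of `SL₂(F)` that becomes `± 1` over an extension is trivial in `PSL₂(F)`. -/
theorem pslMk_pow_eq_one_of_map_pow_eq_smul_one {F K : Type*} [Field F] [Field K] [Algebra F K]
    (A : SpecialLinearGroup (Fin 2) F) {k : ℕ} {c : K} (hc : c * c = 1)
    (h : (A.val.map (algebraMap F K)) ^ k = c • (1 : Matrix (Fin 2) (Fin 2) K)) :
    (QuotientGroup.mk A : ProjectiveSpecialLinearGroup (Fin 2) F) ^ k = 1 := by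
  rw [← QuotientGroup.mk_pow, QuotientGroup.eq_one_iff, Matrix.SpecialLinearGroup.mem_center_iff]
  obtain ⟨e, he, rfl⟩ : ∃ e : F, e * e = 1 ∧ algebraMap F K e = c := by
    rcases mul_self_eq_one_iff.1 hc with rfl | rfl
    · exact ⟨1, by simp⟩
    · exact ⟨-1, by simp⟩
  refine ⟨e, by simpa [sq] using he, ?_⟩
  apply Matrix.map_injective (algebraMap F K).injective
  change (algebraMap F K).mapMatrix _ = (algebraMap F K).mapMatrix _
  rw [Matrix.SpecialLinearGroup.coe_pow, map_pow, RingHom.mapMatrix_apply,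
    RingHom.mapMatrix_apply, h]
  ext i j
  by_cases hij : i = j <;> simp [hij, one_apply]

theorem pow_div_gcd_two_mul_self {M : Type*} [Monoid M] {a : M} {N : ℕ} (h : a ^ N = 1) :
    a ^ (N / N.gcd 2) * a ^ (N / N.gcd 2) = 1 := by
  have hdvd : N ∣ N / N.gcd 2 * 2 := by
    rw [Nat.div_mul_right_comm (Nat.gcd_dvd_left N 2), Nat.mul_div_assoc _ (Nat.gcd_dvd_right N 2)]
    exact dvd_mul_right _ _
  rw [← pow_two, ← pow_mul]
  exact orderOf_dvd_iff_pow_eq_one.1 ((orderOf_dvd_of_pow_eq_one h).trans hdvd)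

theorem div_gcd_two_dvd_of_dvd_two_mul {N k : ℕ} (h : N ∣ 2 * k) : N / N.gcd 2 ∣ k := by
  have hpos : 0 < N.gcd 2 := Nat.gcd_pos_of_pos_right N two_pos
  refine (Nat.coprime_div_gcd_div_gcd hpos).dvd_of_dvd_mul_left ?_
  rw [Nat.div_mul_right_comm (Nat.gcd_dvd_right N 2)]
  exact Nat.div_dvd_div (Nat.gcd_dvd_left N 2) h

open Matrix Polynomial in
/-- Every element of `PSL₂(q)` is unipotent or lies in a split or a nonsplit torus. -/
theorem orderOf_psl2_dvd {F : Type*} [Field F] [Fintype F] (p : ℕ) [Fact p.Prime] [CharP F p]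
    (g : ProjectiveSpecialLinearGroup (Fin 2) F) :
    orderOf g ∣ p ∨ ∃ N, (N = Fintype.card F - 1 ∨ N = Fintype.card F + 1) ∧
      orderOf g ∣ N / N.gcd 2 := by
  obtain ⟨A, rfl⟩ := QuotientGroup.mk_surjective g
  let K := AlgebraicClosure F
  have : CharP K p := charP_of_injective_algebraMap (algebraMap F K).injective p
  let t : K := algebraMap F K A.val.trace
  let B : Matrix (Fin 2) (Fin 2) K := A.val.map (algebraMap F K)
  have hB : B * B = t • B - 1 := by
    have h := congrArg (algebraMap F K).mapMatrix A.mul_self_fin_two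
    rw [map_mul, map_sub, map_one] at h
    refine h.trans ?_
    congr 1
    ext i j
    simp [B, t]
  obtain ⟨a, ha⟩ : ∃ a : K, a * a - t * a + 1 = 0 := by
    obtain ⟨a, ha⟩ := IsAlgClosed.exists_root (C 1 * X ^ 2 + C (-t) * X + C 1 : K[X])
      (by rw [degree_quadratic one_ne_zero]; decide)
    refine ⟨a, ?_⟩
    simp at ha
    linear_combination ha
  set b : K := t - a with hb
  have hab : a * b = 1 := by rw [hb]; linear_combination -ha
  have ha0 : a ≠ 0 := left_ne_zero_of_mul_eq_one hab
  have hB' : B * B = (a + b) • B - (a * b) • 1 := by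
    rw [hB, hab, one_smul, hb, add_sub_cancel]
  by_cases hne : a = b
  · left
    apply orderOf_dvd_of_pow_eq_one
    have haa : a * a = 1 := by rw [← hab, ← hne]
    refine pslMk_pow_eq_one_of_map_pow_eq_smul_one A (c := a ^ p)
      (by rw [← mul_pow, haa, one_pow]) ?_
    have hcomm : Commute B (a • 1) := (Commute.one_right B).smul_right a
    have hnil : (B - a • 1) ^ 2 = 0 := by
      rw [sq]
      simp only [sub_mul, mul_sub, smul_mul_assoc, mul_smul_comm, one_mul, mul_one, hB', ← hne]
      module
    have hpow : (B - a • 1) ^ p = 0 :=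
      pow_eq_zero_of_le (Fact.out : p.Prime).two_le hnil
    rw [sub_pow_char_of_commute p hcomm, _root_.smul_pow, one_pow] at hpow
    exact sub_eq_zero.1 hpow
  · right
    have hfrob : (a ^ Fintype.card F - a) * (a ^ Fintype.card F - b) = 0 := by
      have h := congrArg (FiniteField.frobeniusAlgHom F K) ha
      have ht : t ^ Fintype.card F = t := by
        rw [← map_pow, FiniteField.pow_card]
      simp only [map_add, map_sub, map_mul, map_one, map_zero, FiniteField.frobeniusAlgHom_apply,
        ht] at h
      rw [hb]
      linear_combination h - ha
    obtain ⟨N, hN, haN⟩ : ∃ N, (N = Fintype.card F - 1 ∨ N = Fintype.card F + 1) ∧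
        a ^ N = 1 := by
      rcases mul_eq_zero.1 hfrob with h | h
      · refine ⟨_, .inl rfl, mul_right_cancel₀ ha0 ?_⟩
        rw [← pow_succ, Nat.sub_add_cancel Fintype.card_pos, one_mul, sub_eq_zero.1 h]
      · exact ⟨_, .inr rfl, by rw [pow_succ, sub_eq_zero.1 h, mul_comm, hab]⟩
    refine ⟨N, hN, orderOf_dvd_of_pow_eq_one ?_⟩
    have hsq := pow_div_gcd_two_mul_self haN
    set m := N / N.gcd 2
    refine pslMk_pow_eq_one_of_map_pow_eq_smul_one A hsq ?_
    have hbm : b ^ m = a ^ m := by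
      apply mul_left_cancel₀ (pow_ne_zero m ha0)
      rw [hsq, ← mul_pow, hab, one_pow]
    have h := sub_smul_pow_of_quadratic hB' m
    rw [hbm] at h
    apply smul_right_injective _ (sub_ne_zero.2 hne)
    change (a - b) • B ^ m = (a - b) • a ^ m • (1 : Matrix (Fin 2) (Fin 2) K)
    rw [h]
    module

open Matrix in
/-- `PSL₂(q)` has elements whose order is a multiple of `(q ± 1) / gcd (q ± 1, 2)`. -/
theorem exists_psl2_dvd_orderOf {F : Type*} [Field F] [Fintype F] {N : ℕ}
    (hN : N = Fintype.card F - 1 ∨ N = Fintype.card F + 1) :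
    ∃ g : ProjectiveSpecialLinearGroup (Fin 2) F, N / N.gcd 2 ∣ orderOf g := by
  let K := AlgebraicClosure F
  have hNF : NeZero (N : F) := by
    refine ⟨?_⟩
    rcases hN with rfl | rfl
    · rw [Nat.cast_sub Fintype.card_pos]; simp
    · simp
  obtain ⟨a, ha⟩ := HasEnoughRootsOfUnity.exists_primitiveRoot K N
  have hN0 : N ≠ 0 := by rintro rfl; exact hNF.out Nat.cast_zero
  have ha0 : a ≠ 0 := ha.ne_zero hN0
  have hfrob : (a + a⁻¹) ^ Fintype.card F = a + a⁻¹ := by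
    rw [← FiniteField.frobeniusAlgHom_apply F K, map_add, map_inv₀,
      FiniteField.frobeniusAlgHom_apply]
    have h1 := ha.pow_eq_one
    rcases hN with rfl | rfl
    · have : a ^ Fintype.card F = a := by
        rw [← Nat.sub_add_cancel (Fintype.card_pos (α := F)), pow_succ, h1, one_mul]
      rw [this]
    · have : a ^ Fintype.card F = a⁻¹ := eq_inv_of_mul_eq_one_left (by rw [← pow_succ, h1])
      rw [this, inv_inv, add_comm]
  obtain ⟨t, ht⟩ := exists_algebraMap_eq_of_pow_card_eq_self hfrob
  let A : SpecialLinearGroup (Fin 2) F := ⟨!![t, -1; 1, 0], by simp [det_fin_two]⟩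
  refine ⟨QuotientGroup.mk A, ?_⟩
  set k := orderOf (QuotientGroup.mk A : ProjectiveSpecialLinearGroup (Fin 2) F) with hk
  have hcenter : A ^ k ∈ Subgroup.center (SpecialLinearGroup (Fin 2) F) := by
    rw [← QuotientGroup.eq_one_iff, QuotientGroup.mk_pow, hk, pow_orderOf_eq_one]
  obtain ⟨c, hc, hcA⟩ := Matrix.SpecialLinearGroup.mem_center_iff.1 hcenter
  let B : Matrix (Fin 2) (Fin 2) K := (algebraMap F K).mapMatrix A.val
  have hvec : B *ᵥ ![a, 1] = a • ![a, 1] := by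
    ext i
    fin_cases i <;> simp [B, A, mulVec, dotProduct, Fin.sum_univ_two, ht]
    rw [add_mul, inv_mul_cancel₀ ha0, add_neg_cancel_right]
  have hpow : ∀ n : ℕ, B ^ n *ᵥ ![a, 1] = a ^ n • ![a, 1] := by
    intro n
    induction n with
    | zero => simp
    | succ n ih => rw [pow_succ, ← mulVec_mulVec, hvec, mulVec_smul, ih, smul_smul, pow_succ']
  have hBk : B ^ k = (algebraMap F K).mapMatrix (scalar (Fin 2) c) := by
    rw [hcA, Matrix.SpecialLinearGroup.coe_pow, map_pow]
  have hak : algebraMap F K c = a ^ k := by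
    have h := congrFun (hpow k) 1
    rw [hBk] at h
    simpa [mulVec, dotProduct, Fin.sum_univ_two] using h
  apply div_gcd_two_dvd_of_dvd_two_mul
  rw [← ha.pow_eq_one_iff_dvd, mul_comm, pow_mul, ← hak, ← map_pow]
  simpa using congrArg (algebraMap F K) hc

open Matrix in
/-- For distinct primes `r` and `s`, `PSL₂(q)` has an element of order `r s` iff `r s` divides
one of the orders `(q ± 1) / gcd (q ± 1, 2)` of its maximal tori. -/
theorem exists_psl2_orderOf_eq_mul_iff {F : Type*} [Field F] [Fintype F] {r s : ℕ}
    (hr : r.Prime) (hs : s.Prime) (hrs : r ≠ s) :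
    (∃ g : ProjectiveSpecialLinearGroup (Fin 2) F, orderOf g = r * s) ↔
      ∃ N, (N = Fintype.card F - 1 ∨ N = Fintype.card F + 1) ∧
        r ∣ N / N.gcd 2 ∧ s ∣ N / N.gcd 2 := by
  constructor
  · rintro ⟨g, hg⟩
    obtain ⟨p, hp⟩ := CharP.exists F
    have hpp : p.Prime := CharP.char_is_prime F p
    have : Fact p.Prime := ⟨hpp⟩
    rcases orderOf_psl2_dvd p g with h | ⟨N, hN, h⟩
    · rw [hg] at h
      exact absurd (((Nat.prime_dvd_prime_iff_eq hr hpp).1 (dvd_of_mul_right_dvd h)).trans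
        ((Nat.prime_dvd_prime_iff_eq hs hpp).1 (dvd_of_mul_left_dvd h)).symm) hrs
    · rw [hg] at h
      exact ⟨N, hN, dvd_of_mul_right_dvd h, dvd_of_mul_left_dvd h⟩
  · rintro ⟨N, hN, hrN, hsN⟩
    obtain ⟨g, hg⟩ := exists_psl2_dvd_orderOf hN
    have hdvd := (((Nat.coprime_primes hr hs).2 hrs).mul_dvd_of_dvd_of_dvd hrN hsN).trans hg
    have hpos : orderOf g ≠ 0 := (orderOf_pos g).ne'
    exact ⟨g ^ (orderOf g / (r * s)), orderOf_pow_orderOf_div hpos hdvd⟩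

theorem not_prime_dvd_pred_div_gcd_and_succ_div_gcd {q s : ℕ} (hq : 0 < q) (hs : s.Prime)
    (h₁ : s ∣ (q - 1) / (q - 1).gcd 2) (h₂ : s ∣ (q + 1) / (q + 1).gcd 2) : False := by
  have h₁' := h₁.trans (Nat.div_dvd_of_dvd (Nat.gcd_dvd_left (q - 1) 2))
  have h₂' := h₂.trans (Nat.div_dvd_of_dvd (Nat.gcd_dvd_left (q + 1) 2))
  have hs2 : s ∣ 2 := by
    have h := Nat.dvd_sub h₂' h₁'
    rwa [show q + 1 - (q - 1) = 2 by omega] at h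
  obtain rfl := (Nat.prime_dvd_prime_iff_eq hs Nat.prime_two).1 hs2
  rw [Nat.gcd_eq_right h₁'] at h₁
  rw [Nat.gcd_eq_right h₂'] at h₂
  omega

/-- If adjacency is transitive on distinct vertices, the compact form has no edges. -/
theorem isSplit_compactForm_of_adj_trans {V : Type*} (Γ : SimpleGraph V)
    (h : ∀ u v w, Γ.Adj u v → Γ.Adj v w → u ≠ w → Γ.Adj u w) :
    (compactForm Γ).IsSplit Set.univ := by
  refine ⟨∅, Set.univ, by simp, by simp, by simp, ?_⟩
  rintro a - b - hab ⟨-, u, v, rfl, rfl, huv⟩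
  have hsub : ∀ x y, Γ.Adj x y → closedNbhd Γ x ⊆ closedNbhd Γ y := by
    rintro x y hxy z (rfl | hz)
    · exact .inr hxy.symm
    · by_cases hyz : y = z
      · exact .inl hyz.symm
      · exact .inr (h y x z hxy.symm hz hyz)
  exact hab (Quotient.sound ((hsub u v huv).antisymm (hsub v u huv.symm)))

/-- for every prime power `q ≥ 4` (realized as the cardinality of a
finite field `F`), the compact form of the prime graph of `PSL₂(q)` is split. -/
theorem compactForm_primeGraph_psl2_split (F : Type*) [Field F] [Fintype F]
    (hF : 4 ≤ Fintype.card F) :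
    (compactForm (primeGraphOn (Matrix.ProjectiveSpecialLinearGroup (Fin 2) F))).IsSplit
      Set.univ := by
  apply isSplit_compactForm_of_adj_trans
  rintro ⟨r, hr, _⟩ ⟨s, hs, _⟩ ⟨t, ht, _⟩ ⟨hrs, hg⟩ ⟨hst, hh⟩ hrt
  simp only [ne_eq, Subtype.mk.injEq] at hrs hst
  refine ⟨hrt, ?_⟩
  rw [exists_psl2_orderOf_eq_mul_iff hr hs hrs] at hg
  rw [exists_psl2_orderOf_eq_mul_iff hs ht hst] at hh
  refine (exists_psl2_orderOf_eq_mul_iff hr ht fun h => hrt (Subtype.ext h)).2 ?_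
  obtain ⟨N, hN, hrN, hsN⟩ := hg
  obtain ⟨M, hM, hsM, htM⟩ := hh
  rcases hN with rfl | rfl <;> rcases hM with rfl | rfl
  · exact ⟨_, .inl rfl, hrN, htM⟩
  · exact (not_prime_dvd_pred_div_gcd_and_succ_div_gcd Fintype.card_pos hs hsN hsM).elim
  · exact (not_prime_dvd_pred_div_gcd_and_succ_div_gcd Fintype.card_pos hs hsM hsN).elim
  · exact ⟨_, .inr rfl, hrN, htM⟩
end
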